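/- For every function e : ℝ → ℝ, the operator T^e is a γ-contraction with respect to the sup-norm (for all v₁, v₂ : S × ℝ → ℝ and C ≥ 0, if |v₁(s,z) − v₂(s,z)| ≤ C for all (s,z) then |T^e v₁(s,z) − T^e v₂(s,z)| ≤ γ·C for all (s,z)), and T^e admits exactly one bounded fixed point v : S × ℝ → ℝ with T^e v = v. -/

import Mathlib

/-- The clamp `p(x) = max (−c) (min x c)`. -/
noncomputable def clampP (c : ℝ) (x : ℝ) : ℝ := max (-c) (min x c)

/-- The bounding operator `T^e`:
`T^e v (s, z) = max_{a ∈ A} [min 0 (r s a + z) - min 0 z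
  + γ * Σ_{s'} P(s'|s,a) * v (s', p (e ((r s a + z) / γ)))]`,
where `p` is the clamp to `[-rγ, rγ]`. `T^p` is the case `e = id`. -/
noncomputable def Te {S A : Type*} [Fintype S] [Fintype A] [Nonempty A]
    (P : S → A → PMF S) (r : S → A → ℝ) (γ rγ : ℝ) (e : ℝ → ℝ)
    (v : S × ℝ → ℝ) : S × ℝ → ℝ :=
  fun x => Finset.univ.sup' Finset.univ_nonempty fun a =>
    min 0 (r x.1 a + x.2) - min 0 x.2
      + γ * ∑ s' : S, ((P x.1 a) s').toReal *
          v (s', clampP rγ (e ((r x.1 a + x.2) / γ)))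


open scoped BoundedContinuousFunction in
/-- An operator on real functions which is a sup-norm contraction and sends some bounded function
to a bounded one has exactly one bounded fixed point. -/
theorem existsUnique_bounded_fixedPoint {X : Type*} {γ : ℝ} (hγ : γ ∈ Set.Ioo (0 : ℝ) 1)
    (T : (X → ℝ) → X → ℝ)
    (hT : ∀ (v w : X → ℝ) (C : ℝ), 0 ≤ C → (∀ x, |v x - w x| ≤ C) →
      ∀ x, |T v x - T w x| ≤ γ * C)
    {B : ℝ} (hB : ∀ x, |T 0 x| ≤ B) :
    ∃! v : X → ℝ, (∃ M : ℝ, ∀ x, |v x| ≤ M) ∧ T v = v := by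
  let _ : TopologicalSpace X := ⊥
  have _ : DiscreteTopology X := ⟨rfl⟩
  have hbdd : ∀ f : X →ᵇ ℝ, ∀ x, ‖T f x‖ ≤ γ * ‖f‖ + B := by
    intro f x
    have h := hT f 0 ‖f‖ (norm_nonneg f) (fun y => by simpa using f.norm_coe_le_norm y) x
    have h' := abs_add_le (T f x - T 0 x) (T 0 x)
    rw [sub_add_cancel] at h'
    rw [Real.norm_eq_abs]
    linarith [hB x]
  let F : (X →ᵇ ℝ) → X →ᵇ ℝ := fun f =>
    BoundedContinuousFunction.ofNormedAddCommGroupDiscrete (T f) _ (hbdd f)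
  have hF : ContractingWith ⟨γ, hγ.1.le⟩ F := by
    refine ⟨hγ.2, LipschitzWith.of_dist_le_mul fun f g => ?_⟩
    refine (BoundedContinuousFunction.dist_le (mul_nonneg hγ.1.le dist_nonneg)).2 fun x => ?_
    exact hT f g (dist f g) dist_nonneg (fun y => f.dist_coe_le_dist y) x
  refine ⟨(hF.fixedPoint F : X →ᵇ ℝ), ⟨⟨_, (hF.fixedPoint F).norm_coe_le_norm⟩, ?_⟩, ?_⟩
  · exact congrArg (fun f : X →ᵇ ℝ => (f : X → ℝ)) hF.fixedPoint_isFixedPt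
  · rintro v ⟨⟨M, hM⟩, hv⟩
    have hfix : Function.IsFixedPt F
        (BoundedContinuousFunction.ofNormedAddCommGroupDiscrete v M hM) :=
      DFunLike.coe_injective hv
    exact congrArg (fun f : X →ᵇ ℝ => (f : X → ℝ)) (hF.fixedPoint_unique hfix)

/-- Taking finite maxima is nonexpansive for the sup-norm. -/
theorem Finset.abs_sup'_sub_sup'_le {ι : Type*} {s : Finset ι} (hs : s.Nonempty) {f g : ι → ℝ}
    {C : ℝ} (h : ∀ i ∈ s, |f i - g i| ≤ C) : |s.sup' hs f - s.sup' hs g| ≤ C := by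
  have key : ∀ f g : ι → ℝ, (∀ i ∈ s, |f i - g i| ≤ C) → s.sup' hs f ≤ C + s.sup' hs g :=
    fun f g h => Finset.sup'_le hs f fun i hi => by
      linarith [(abs_le.1 (h i hi)).2, Finset.le_sup' g hi]
  rw [abs_le]
  constructor
  · linarith [key g f fun i hi => abs_sub_comm (f i) (g i) ▸ h i hi]
  · linarith [key f g h]

/-- The real-valued weights of a `PMF` on a finite type sum to one. -/
theorem PMF.sum_toReal_eq_one {S : Type*} [Fintype S] (p : PMF S) : ∑ s, (p s).toReal = 1 := by
  rw [← ENNReal.toReal_sum fun s _ => p.apply_ne_top s, ← tsum_fintype (L := .unconditional S) (fun s => p s),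
    p.tsum_coe, ENNReal.toReal_one]

/-- Averaging against a `PMF` on a finite type is nonexpansive for the sup-norm. -/
theorem PMF.abs_sum_sub_sum_le {S : Type*} [Fintype S] (p : PMF S) {f g : S → ℝ} {C : ℝ}
    (h : ∀ s, |f s - g s| ≤ C) :
    |∑ s, (p s).toReal * f s - ∑ s, (p s).toReal * g s| ≤ C := by
  calc |∑ s, (p s).toReal * f s - ∑ s, (p s).toReal * g s|
      = |∑ s, (p s).toReal * (f s - g s)| := by simp only [mul_sub, Finset.sum_sub_distrib]
    _ ≤ ∑ s, |(p s).toReal * (f s - g s)| := Finset.abs_sum_le_sum_abs _ _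
    _ ≤ ∑ s, (p s).toReal * C := Finset.sum_le_sum fun s _ => by
        rw [abs_mul, abs_of_nonneg ENNReal.toReal_nonneg]
        exact mul_le_mul_of_nonneg_left (h s) ENNReal.toReal_nonneg
    _ = C := by rw [← Finset.sum_mul, p.sum_toReal_eq_one, one_mul]

/-- `T^e` is a `γ`-contraction for the sup-norm. -/
theorem abs_Te_sub_Te_le {S A : Type*} [Fintype S] [Fintype A] [Nonempty A]
    (P : S → A → PMF S) (r : S → A → ℝ) {γ : ℝ} (hγ : 0 ≤ γ) (rγ : ℝ) (e : ℝ → ℝ)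
    {v w : S × ℝ → ℝ} {C : ℝ} (h : ∀ x, |v x - w x| ≤ C) (x : S × ℝ) :
    |Te P r γ rγ e v x - Te P r γ rγ e w x| ≤ γ * C := by
  refine Finset.abs_sup'_sub_sup'_le _ fun a _ => ?_
  rw [add_sub_add_left_eq_sub, ← mul_sub, abs_mul, abs_of_nonneg hγ]
  exact mul_le_mul_of_nonneg_left ((P x.1 a).abs_sum_sub_sum_le fun s => h _) hγ

/-- `T^e 0` is bounded by any bound on the rewards. -/
theorem abs_Te_zero_le {S A : Type*} [Fintype S] [Fintype A] [Nonempty A]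
    (P : S → A → PMF S) {r : S → A → ℝ} {R : ℝ} (hr : ∀ s a, |r s a| ≤ R) (γ rγ : ℝ)
    (e : ℝ → ℝ) (x : S × ℝ) : |Te P r γ rγ e 0 x| ≤ R := by
  have h : ∀ a, |min 0 (r x.1 a + x.2) - min 0 x.2| ≤ R := fun a => by
    refine (abs_min_sub_min_le_max _ _ _ _).trans ?_
    simpa using hr x.1 a
  simp only [Te, Pi.zero_apply, mul_zero, Finset.sum_const_zero, add_zero]
  simpa using Finset.abs_sup'_sub_sup'_le (g := fun _ => 0) Finset.univ_nonempty
    fun a _ => by simpa using h a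

/-- for every `e : ℝ → ℝ`, the operator `T^e` is a `γ`-contraction in sup-norm
and admits exactly one bounded fixed point. -/
theorem Te_contraction_and_uniqueFixedPoint
    {S A : Type*} [Fintype S] [Nonempty S] [Fintype A] [Nonempty A]
    (P : S → A → PMF S) (r : S → A → ℝ) (r_max : ℝ) (hr_max : 0 < r_max)
    (hr : ∀ s a, |r s a| ≤ r_max) (γ : ℝ) (hγ : γ ∈ Set.Ioo (0 : ℝ) 1)
    (e : ℝ → ℝ) :
    (∀ (v₁ v₂ : S × ℝ → ℝ) (C : ℝ), 0 ≤ C → (∀ s z, |v₁ (s, z) - v₂ (s, z)| ≤ C) →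
      ∀ s z, |Te P r γ (r_max / (1 - γ)) e v₁ (s, z)
                - Te P r γ (r_max / (1 - γ)) e v₂ (s, z)| ≤ γ * C) ∧
    (∃! v : S × ℝ → ℝ,
      (∃ M : ℝ, ∀ s z, |v (s, z)| ≤ M) ∧ Te P r γ (r_max / (1 - γ)) e v = v) := by
  have hcontr : ∀ (v w : S × ℝ → ℝ) (C : ℝ), 0 ≤ C → (∀ x, |v x - w x| ≤ C) →
      ∀ x, |Te P r γ (r_max / (1 - γ)) e v x - Te P r γ (r_max / (1 - γ)) e w x| ≤ γ * C :=
    fun v w C _ h x => abs_Te_sub_Te_le P r hγ.1.le _ e h x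
  refine ⟨fun v w C hC h s z => hcontr v w C hC (fun x => h x.1 x.2) (s, z), ?_⟩
  simpa only [Prod.forall] using existsUnique_bounded_fixedPoint hγ _ hcontr
    (abs_Te_zero_le P hr γ (r_max / (1 - γ)) e)
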